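/- arXiv:math/0508079 — 2 statements merged into one kernel-verified Lean document; each statement's English description precedes it below -/
import Mathlib

section
/- Let ℓ ≥ 3 be an odd integer. For every x ∈ O₂ with normSq(x) = 1, and for every natural number n, there exists γ ∈ ℍ[ℚ] such that γ ∈ O[1/ℓ], normSq(γ) = 1, and x - ι(γ) ∈ 2ⁿ·O₂ (i.e. x - ι(γ) = 2ⁿ·y for some y ∈ O₂). (This expresses that the group Γ¹ of norm-one quasi-endomorphisms is dense in the norm-one subgroup Sl₂ of the second Morava stabilizer group at p = 2.) -/
open Quaternion

/-- The Hurwitz quaternions: the subring of `ℍ[ℚ]` generated by `i`, `j` and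
`ω = (1 + i + j + k)/2`. -/
noncomputable def HurwitzOrder : Subring ℍ[ℚ] :=
  Subring.closure {(⟨0, 1, 0, 0⟩ : ℍ[ℚ]), ⟨0, 0, 1, 0⟩, ⟨1/2, 1/2, 1/2, 1/2⟩}

/-- `O[1/ℓ]`: the subring of `ℍ[ℚ]` generated by the Hurwitz order and `1/ℓ`. -/
noncomputable def HurwitzOrderInvLoc (ℓ : ℕ) : Subring ℍ[ℚ] :=
  Subring.closure ((HurwitzOrder : Set ℍ[ℚ]) ∪ {((ℓ : ℚ)⁻¹ : ℚ) • (1 : ℍ[ℚ])})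

/-- The maximal order `O₂` of the quaternion algebra `ℍ[ℚ₂]`: the subring generated
by `ℤ₂`, `i`, `j`, and `ω = (1 + i + j + k)/2`.  Its unit group is the second Morava
stabilizer group at `p = 2`. -/
noncomputable def MaximalOrderQ2 : Subring ℍ[ℚ_[2]] :=
  Subring.closure
    ({(⟨0, 1, 0, 0⟩ : ℍ[ℚ_[2]]), ⟨0, 0, 1, 0⟩, ⟨1/2, 1/2, 1/2, 1/2⟩} ∪
      {x : ℍ[ℚ_[2]] | ∃ z : ℤ_[2], x = algebraMap ℚ_[2] ℍ[ℚ_[2]] (z : ℚ_[2])})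

/-- The coordinatewise inclusion `ℍ[ℚ] → ℍ[ℚ₂]`. -/
noncomputable def iotaQ2 : ℍ[ℚ] → ℍ[ℚ_[2]] :=
  fun x => ⟨(x.re : ℚ_[2]), (x.imI : ℚ_[2]), (x.imJ : ℚ_[2]), (x.imK : ℚ_[2])⟩

/-- The symmetric matrix `[[a, t, s], [t, b, r], [s, r, c]]` is the Gram matrix of three vectors
of `ℤ³`. -/
def IsGramMatrix (a b c r s t : ℤ) : Prop :=
  ∃ u v w : Fin 3 → ℤ, u ⬝ᵥ u = a ∧ v ⬝ᵥ v = b ∧ w ⬝ᵥ w = c ∧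
    v ⬝ᵥ w = r ∧ u ⬝ᵥ w = s ∧ u ⬝ᵥ v = t

namespace IsGramMatrix

variable {a b c r s t : ℤ}

lemma swap_left (h : IsGramMatrix b a c s r t) : IsGramMatrix a b c r s t := by
  obtain ⟨u, v, w, h1, h2, h3, h4, h5, h6⟩ := h
  exact ⟨v, u, w, h2, h1, h3, h5, h4, by rw [dotProduct_comm, h6]⟩

lemma swap_right (h : IsGramMatrix a c b r t s) : IsGramMatrix a b c r s t := by
  obtain ⟨u, v, w, h1, h2, h3, h4, h5, h6⟩ := h
  exact ⟨u, w, v, h1, h3, h2, by rw [dotProduct_comm, h4], h6, h5⟩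

lemma shear_left (k : ℤ)
    (h : IsGramMatrix a (b + 2 * k * t + k ^ 2 * a) c (r + k * s) s (t + k * a)) :
    IsGramMatrix a b c r s t := by
  obtain ⟨u, v, w, h1, h2, h3, h4, h5, h6⟩ := h
  refine ⟨u, v - k • u, w, h1, ?_, h3, ?_, h5, ?_⟩
  · simp only [sub_dotProduct, dotProduct_sub, smul_dotProduct, dotProduct_smul, smul_eq_mul,
      dotProduct_comm v u, h1, h2, h6]
    ring
  · simp only [sub_dotProduct, smul_dotProduct, smul_eq_mul, h4, h5]
    ring
  · simp only [dotProduct_sub, dotProduct_smul, smul_eq_mul, h1, h6]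
    ring

lemma shear_right (k : ℤ)
    (h : IsGramMatrix a b (c + 2 * k * r + k ^ 2 * b) (r + k * b) (s + k * t) t) :
    IsGramMatrix a b c r s t := by
  obtain ⟨u, v, w, h1, h2, h3, h4, h5, h6⟩ := h
  refine ⟨u, v, w - k • v, h1, h2, ?_, ?_, ?_, h6⟩
  · simp only [sub_dotProduct, dotProduct_sub, smul_dotProduct, dotProduct_smul, smul_eq_mul,
      dotProduct_comm w v, h2, h3, h4]
    ring
  · simp only [dotProduct_sub, dotProduct_smul, smul_eq_mul, h2, h4]
    ring
  · simp only [dotProduct_sub, dotProduct_smul, smul_eq_mul, h5, h6]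
    ring

end IsGramMatrix

lemma exists_two_mul_abs_add_mul_le (x : ℤ) {a : ℤ} (ha : 0 < a) :
    ∃ k : ℤ, 2 * |x + k * a| ≤ a := by
  have h1 := Int.emod_nonneg x ha.ne'
  have h2 := Int.emod_lt_of_pos x ha
  have h3 := Int.emod_add_mul_ediv x a
  by_cases h : 2 * (x % a) ≤ a
  · refine ⟨-(x / a), ?_⟩
    rw [show x + -(x / a) * a = x % a by linarith, abs_of_nonneg h1]
    exact h
  · refine ⟨-(x / a) - 1, ?_⟩
    rw [show x + (-(x / a) - 1) * a = x % a - a by linarith, abs_of_neg (by linarith)]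
    linarith

/-- A positive definite integral ternary form which is reduced and has determinant one
is the Gram matrix of three vectors of `ℤ³`. -/
lemma isGramMatrix_of_reduced {a b c r s t : ℤ} (ha : 0 < a) (hA : 0 < a * b - t ^ 2)
    (hdet : a * b * c + 2 * r * s * t - a * r ^ 2 - b * s ^ 2 - c * t ^ 2 = 1)
    (hB : 2 * |a * r - t * s| ≤ a * b - t ^ 2) (hAC : a * b - t ^ 2 ≤ a * c - s ^ 2)
    (ht : 2 * |t| ≤ a) (hab : a ≤ b) : IsGramMatrix a b c r s t := by
  have hB' : 4 * (a * r - t * s) ^ 2 ≤ (a * b - t ^ 2) ^ 2 := by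
    rw [← sq_abs (a * r - t * s)]
    nlinarith [abs_nonneg (a * r - t * s)]
  have ht' : 4 * t ^ 2 ≤ a ^ 2 := by
    rw [← sq_abs t]
    nlinarith [abs_nonneg t]
  have hdisc : (a * b - t ^ 2) * (a * c - s ^ 2) - (a * r - t * s) ^ 2 = a := by
    linear_combination a * hdet
  have hA2 : 3 * (a * b - t ^ 2) ^ 2 ≤ 4 * a := by nlinarith
  have haA : 3 * a ^ 2 ≤ 4 * (a * b - t ^ 2) := by nlinarith
  have ha1 : a = 1 := by
    by_contra hne
    have h2 : 2 ≤ a := by omega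
    have h3 : 9 * a ^ 4 ≤ 16 * (a * b - t ^ 2) ^ 2 := by nlinarith [sq_nonneg a]
    have h4 : 27 * a ^ 4 ≤ 64 * a := by linarith
    have h5 : 8 * a ≤ a ^ 4 := by nlinarith [sq_nonneg (a ^ 2 - 4), sq_nonneg (a - 2)]
    linarith
  subst ha1
  have ht0 : t = 0 := by
    rw [← abs_eq_zero]
    have := abs_nonneg t
    omega
  subst ht0
  have hb1 : b = 1 := by nlinarith
  subst hb1
  have hr0 : r = 0 := by
    rw [← abs_eq_zero]
    have := abs_nonneg r
    norm_num at hB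
    omega
  subst hr0
  refine ⟨![1, 0, 0], ![0, 1, 0], ![s, 0, 1], ?_, ?_, ?_, ?_, ?_, ?_⟩ <;>
    simp [dotProduct, Fin.sum_univ_three]
  linarith

/-- Every positive definite integral ternary form of determinant one is equivalent to a sum of
three squares. -/
theorem isGramMatrix_of_det_eq_one {a b c r s t : ℤ} (ha : 0 < a) (hA : 0 < a * b - t ^ 2)
    (hdet : a * b * c + 2 * r * s * t - a * r ^ 2 - b * s ^ 2 - c * t ^ 2 = 1) :
    IsGramMatrix a b c r s t := by
  obtain ⟨N, hN⟩ : ∃ N : ℕ, a.toNat = N := ⟨_, rfl⟩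
  induction N using Nat.strong_induction_on generalizing a b c r s t with
  | _ N ihN =>
  obtain ⟨M, hM⟩ : ∃ M : ℕ, (a * b - t ^ 2).toNat = M := ⟨_, rfl⟩
  induction M using Nat.strong_induction_on generalizing a b c r s t with
  | _ M ihM =>
  obtain ⟨k, hk⟩ := exists_two_mul_abs_add_mul_le (a * r - t * s) hA
  refine .shear_right k ?_
  have hB : 2 * |a * (r + k * b) - t * (s + k * t)| ≤ a * b - t ^ 2 := by
    rwa [show a * (r + k * b) - t * (s + k * t) = a * r - t * s + k * (a * b - t ^ 2) by ring]
  have hdet' : a * b * (c + 2 * k * r + k ^ 2 * b) + 2 * (r + k * b) * (s + k * t) * t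
      - a * (r + k * b) ^ 2 - b * (s + k * t) ^ 2 - (c + 2 * k * r + k ^ 2 * b) * t ^ 2 = 1 := by
    linear_combination hdet
  generalize c + 2 * k * r + k ^ 2 * b = c at *
  generalize r + k * b = r at *
  generalize s + k * t = s at *
  by_cases hAC : a * b - t ^ 2 ≤ a * c - s ^ 2
  · obtain ⟨l, hl⟩ := exists_two_mul_abs_add_mul_le t ha
    refine .shear_left l ?_
    by_cases hab : a ≤ b + 2 * l * t + l ^ 2 * a
    · refine isGramMatrix_of_reduced ha ?_ ?_ ?_ ?_ hl hab
      · linear_combination hA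
      · linear_combination hdet'
      · rw [show a * (r + l * s) - (t + l * a) * s = a * r - t * s by ring]
        linear_combination hB
      · linear_combination hAC
    · have hb : 0 < b + 2 * l * t + l ^ 2 * a := by
        have : 0 < a * (b + 2 * l * t + l ^ 2 * a) := by nlinarith [sq_nonneg (t + l * a)]
        exact pos_of_mul_pos_right this ha.le
      refine .swap_left (ihN _ ?_ hb ?_ ?_ rfl)
      · omega
      · linear_combination hA
      · linear_combination hdet'
  · have hC : 0 < a * c - s ^ 2 := by
      have h : (a * b - t ^ 2) * (a * c - s ^ 2) = a + (a * r - t * s) ^ 2 := by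
        linear_combination a * hdet'
      have : 0 < (a * b - t ^ 2) * (a * c - s ^ 2) := by rw [h]; positivity
      exact pos_of_mul_pos_right this hA.le
    refine .swap_right (ihM _ ?_ ha hC ?_ hN rfl)
    · omega
    · linear_combination hdet'

/-- Every natural number congruent to `2` modulo `4` is a sum of three squares. -/
theorem exists_sum_three_squares_of_mod_four_eq_two {m : ℕ} (hm : m % 4 = 2) :
    ∃ x y z : ℤ, x ^ 2 + y ^ 2 + z ^ 2 = m := by
  have hunit : IsUnit ((m - 1 : ℕ) : ZMod (4 * m)) := by
    rw [ZMod.isUnit_iff_coprime]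
    refine Nat.Coprime.mul_right ?_ ?_
    · have : Nat.Coprime (m - 1) 2 := by
        rw [Nat.coprime_two_right, Nat.odd_iff]; omega
      exact Nat.Coprime.mul_right this this
    · have := Nat.coprime_self_add_right (m := m - 1) (n := 1)
      rw [show m - 1 + 1 = m by omega] at this
      simpa using this
  have : NeZero (4 * m) := ⟨by omega⟩
  obtain ⟨q, hqm, hq, hmod⟩ := Nat.forall_exists_prime_gt_and_eq_mod hunit m
  rw [ZMod.natCast_eq_natCast_iff] at hmod
  obtain ⟨v, hv⟩ : 4 * m ∣ q - (m - 1) := (Nat.modEq_iff_dvd' (by omega)).1 hmod.symm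
  have hbq : q + 1 = (4 * v + 1) * m := by
    have : q = 4 * m * v + (m - 1) := by omega
    rw [this]
    have : m - 1 + 1 = m := by omega
    linear_combination this
  have hq4 : q % 4 = 1 := by
    have : (4 * v + 1) * m % 4 = 2 := by rw [Nat.mul_mod, hm]; omega
    omega
  have : Fact q.Prime := ⟨hq⟩
  set b := 4 * v + 1 with hb
  have hsymb : jacobiSym (-(b : ℤ)) q = 1 := by
    have hqodd : Odd q := Nat.odd_iff.2 (by omega)
    have hbodd : Odd b := Nat.odd_iff.2 (by omega)
    rw [jacobiSym.neg _ hqodd, ZMod.χ₄_nat_one_mod_four hq4, one_mul,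
      jacobiSym.quadratic_reciprocity_one_mod_four (by omega) hqodd]
    have : jacobiSym (q : ℤ) b = jacobiSym (-1) b := by
      apply jacobiSym.mod_left'
      apply Int.ModEq.symm
      rw [Int.modEq_iff_dvd]
      exact ⟨m, by rw [sub_neg_eq_add]; exact_mod_cast hbq⟩
    rw [this, jacobiSym.at_neg_one hbodd, ZMod.χ₄_nat_one_mod_four (by omega)]
  rw [← jacobiSym.legendreSym.to_jacobiSym] at hsymb
  obtain ⟨y, hy⟩ : IsSquare (-(b : ZMod q)) := by
    have h0 : ((-(b : ℤ) : ℤ) : ZMod q) ≠ 0 := by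
      intro h
      rw [← legendreSym.eq_zero_iff] at h
      omega
    have := (legendreSym.eq_one_iff q h0).1 hsymb
    simpa using this
  obtain ⟨a, ha⟩ : (q : ℤ) ∣ (y.val : ℤ) ^ 2 + b := by
    rw [← ZMod.intCast_zmod_eq_zero_iff_dvd]
    push_cast
    rw [ZMod.natCast_zmod_val, pow_two, ← hy]
    ring
  have hbq' : (q : ℤ) + 1 = b * m := by exact_mod_cast hbq
  have hqpos : (0 : ℤ) < q := by exact_mod_cast hq.pos
  have hbpos : (0 : ℤ) < b := by omega
  have hapos : 0 < a := by
    have : 0 < (q : ℤ) * a := by rw [← ha]; positivity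
    exact pos_of_mul_pos_right this hqpos.le
  obtain ⟨-, -, w, -, -, hw, -⟩ := isGramMatrix_of_det_eq_one (a := a) (b := q) (c := m)
    (r := 0) (s := 1) (t := y.val) hapos (by linarith)
    (by linear_combination -(m : ℤ) * ha - hbq')
  refine ⟨w 0, w 1, w 2, ?_⟩
  rw [← hw]
  simp only [dotProduct, Fin.sum_univ_three]
  ring

section Coordinates

variable {R : Type*} [CommRing R]

/-- The quaternion with the given coordinates. -/
def quat (a b c d : R) : ℍ[R] := ⟨a, b, c, d⟩

@[simp] lemma quat_re (a b c d : R) : (quat a b c d).re = a := rfl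

@[simp] lemma quat_imI (a b c d : R) : (quat a b c d).imI = b := rfl

@[simp] lemma quat_imJ (a b c d : R) : (quat a b c d).imJ = c := rfl

@[simp] lemma quat_imK (a b c d : R) : (quat a b c d).imK = d := rfl

@[simp] lemma Quaternion.re_two : (2 : ℍ[R]).re = 2 := rfl

@[simp] lemma Quaternion.imI_two : (2 : ℍ[R]).imI = 0 := rfl

@[simp] lemma Quaternion.imJ_two : (2 : ℍ[R]).imJ = 0 := rfl

@[simp] lemma Quaternion.imK_two : (2 : ℍ[R]).imK = 0 := rfl

end Coordinates

section TwoAdicIntegers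

lemma PadicInt.exists_eq_two_mul_or (a : ℤ_[2]) : ∃ b : ℤ_[2], a = 2 * b ∨ a = 2 * b + 1 := by
  obtain ⟨n, hn, h⟩ := PadicInt.exists_mem_range (p := 2) a
  rw [PadicInt.maximalIdeal_eq_span_p, Ideal.mem_span_singleton] at h
  obtain ⟨b, hb⟩ := h
  refine ⟨b, ?_⟩
  interval_cases n
  · left; linear_combination hb
  · right; linear_combination hb

lemma PadicInt.two_mul_ne_one (a : ℤ_[2]) : 2 * a ≠ 1 := fun h =>
  PadicInt.p_nonunit (p := 2) (IsUnit.of_mul_eq_one a h)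

@[simp] lemma PadicInt.coe_two : ((2 : ℤ_[2]) : ℚ_[2]) = 2 := rfl

lemma PadicInt.exists_mul_natCast_eq_one {l : ℕ} (hl : Odd l) : ∃ r : ℤ_[2], r * l = 1 := by
  have : IsUnit (l : ℤ_[2]) := by
    rw [PadicInt.isUnit_iff, PadicInt.norm_natCast_eq_one_iff]
    exact (Nat.coprime_two_left).2 hl
  exact this.exists_left_inv

end TwoAdicIntegers

section MaximalOrder

lemma mem_maximalOrderQ2_iff {x : ℍ[ℚ_[2]]} : x ∈ MaximalOrderQ2 ↔
    ∃ a b c d : ℤ_[2], x = quat (a + d / 2 : ℚ_[2]) (b + d / 2) (c + d / 2) (d / 2) := by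
  constructor
  · intro hx
    induction hx using Subring.closure_induction with
    | mem x hx =>
      rcases hx with (rfl | rfl | rfl) | ⟨z, rfl⟩
      · exact ⟨0, 1, 0, 0, by ext <;> simp⟩
      · exact ⟨0, 0, 1, 0, by ext <;> simp⟩
      · exact ⟨0, 0, 0, 1, by ext <;> simp⟩
      · exact ⟨z, 0, 0, 0, by ext <;> simp⟩
    | zero => exact ⟨0, 0, 0, 0, by ext <;> simp⟩
    | one => exact ⟨1, 0, 0, 0, by ext <;> simp⟩
    | add x y _ _ hx hy =>
      obtain ⟨a, b, c, d, rfl⟩ := hx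
      obtain ⟨a', b', c', d', rfl⟩ := hy
      refine ⟨a + a', b + b', c + c', d + d', ?_⟩
      ext <;> simp <;> ring
    | neg x _ hx =>
      obtain ⟨a, b, c, d, rfl⟩ := hx
      refine ⟨-a, -b, -c, -d, ?_⟩
      ext <;> simp <;> ring
    | mul x y _ _ hx hy =>
      obtain ⟨a, b, c, d, rfl⟩ := hx
      obtain ⟨a', b', c', d', rfl⟩ := hy
      refine ⟨a * a' - b * b' - c * c' - b * c' + c * b' - b * d' - d * c' - d * d',
        a * b' + b * a' - b * c' + c * b' + d * b' + c * d' - d * c',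
        a * c' + c * a' - b * c' + c * b' - b * d' + c * d' + d * b',
        a * d' + 2 * b * c' + b * d' + d * c' - 2 * c * b' - c * d' - d * b' + d * a' + d * d',
        ?_⟩
      ext <;> simp <;> ring
  · rintro ⟨a, b, c, d, rfl⟩
    have hz (z : ℤ_[2]) : algebraMap ℚ_[2] ℍ[ℚ_[2]] (z : ℚ_[2]) ∈ MaximalOrderQ2 :=
      Subring.subset_closure (.inr ⟨z, rfl⟩)
    have hi : quat (0 : ℚ_[2]) 1 0 0 ∈ MaximalOrderQ2 :=
      Subring.subset_closure (.inl (.inl rfl))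
    have hj : quat (0 : ℚ_[2]) 0 1 0 ∈ MaximalOrderQ2 :=
      Subring.subset_closure (.inl (.inr (.inl rfl)))
    have hw : quat (1 / 2 : ℚ_[2]) (1 / 2) (1 / 2) (1 / 2) ∈ MaximalOrderQ2 :=
      Subring.subset_closure (.inl (.inr (.inr rfl)))
    convert add_mem (add_mem (hz a) (mul_mem (hz b) hi))
      (add_mem (mul_mem (hz c) hj) (mul_mem (hz d) hw)) using 1
    ext <;> simp <;> ring

lemma mk_intCoords_mem_maximalOrderQ2 (a b c d : ℤ_[2]) :
    quat (a : ℚ_[2]) b c d ∈ MaximalOrderQ2 :=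
  mem_maximalOrderQ2_iff.2 ⟨a - d, b - d, c - d, 2 * d, by ext <;> simp⟩

lemma star_mem_maximalOrderQ2 {x : ℍ[ℚ_[2]]} (hx : x ∈ MaximalOrderQ2) :
    star x ∈ MaximalOrderQ2 := by
  obtain ⟨a, b, c, d, rfl⟩ := mem_maximalOrderQ2_iff.1 hx
  refine mem_maximalOrderQ2_iff.2 ⟨a + d, -b, -c, -d, ?_⟩
  ext <;> simp <;> ring

/-- The maximal ideal of `O₂`, which consists of the quaternions with coordinates in `ℤ₂` whose
sum is even. -/
noncomputable def maximalIdealQ2 : AddSubgroup ℍ[ℚ_[2]] where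
  carrier := {x | ∃ a b c d e : ℤ_[2], x = quat (a : ℚ_[2]) b c d ∧ a + b + c + d = 2 * e}
  zero_mem' := ⟨0, 0, 0, 0, 0, by ext <;> simp, by simp⟩
  add_mem' := by
    rintro _ _ ⟨a, b, c, d, e, rfl, h⟩ ⟨a', b', c', d', e', rfl, h'⟩
    exact ⟨a + a', b + b', c + c', d + d', e + e', by ext <;> simp, by linear_combination h + h'⟩
  neg_mem' := by
    rintro _ ⟨a, b, c, d, e, rfl, h⟩
    exact ⟨-a, -b, -c, -d, -e, by ext <;> simp, by linear_combination -h⟩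

lemma mem_maximalOrderQ2_of_mem_maximalIdealQ2 {x : ℍ[ℚ_[2]]} (hx : x ∈ maximalIdealQ2) :
    x ∈ MaximalOrderQ2 := by
  obtain ⟨a, b, c, d, e, rfl, -⟩ := hx
  exact mk_intCoords_mem_maximalOrderQ2 a b c d

lemma mul_mem_maximalIdealQ2 {x y : ℍ[ℚ_[2]]} (hx : x ∈ MaximalOrderQ2)
    (hy : y ∈ maximalIdealQ2) : x * y ∈ maximalIdealQ2 := by
  obtain ⟨a, b, c, d, rfl⟩ := mem_maximalOrderQ2_iff.1 hx
  obtain ⟨s, f, g, h, e, rfl, hs⟩ := hy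
  obtain rfl : s = 2 * e - f - g - h := by linear_combination hs
  refine ⟨a * (2 * e - f - g - h) - b * f - c * g + d * (e - f - g - h),
    a * f + b * (2 * e - f - g - h) + c * h + d * (e - g),
    a * g - b * h + c * (2 * e - f - g - h) + d * (e - h),
    a * h + b * g - c * f + d * (e - f),
    a * e + b * (e - f - h) + c * (e - f - g) + d * (2 * e - f - g - h), ?_, by ring⟩
  ext <;> simp <;> ring

lemma two_mul_mem_maximalIdealQ2 {x : ℍ[ℚ_[2]]} (hx : x ∈ MaximalOrderQ2) :
    2 * x ∈ maximalIdealQ2 := by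
  obtain ⟨a, b, c, d, rfl⟩ := mem_maximalOrderQ2_iff.1 hx
  refine ⟨2 * a + d, 2 * b + d, 2 * c + d, d, a + b + c + 2 * d, ?_, by ring⟩
  ext <;> simp <;> ring

lemma exists_sq_eq_two_mul_of_mem_maximalIdealQ2 {x : ℍ[ℚ_[2]]} (hx : x ∈ maximalIdealQ2) :
    ∃ y ∈ MaximalOrderQ2, x ^ 2 = 2 * y := by
  obtain ⟨s, f, g, h, e, rfl, hs⟩ := hx
  obtain rfl : s = 2 * e - f - g - h := by linear_combination hs
  set s := 2 * e - f - g - h with hs'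
  refine ⟨_, mk_intCoords_mem_maximalOrderQ2
    (s * s - (2 * e ^ 2 - (s * (f + g + h) + f * g + f * h + g * h))) (s * f) (s * g) (s * h), ?_⟩
  rw [pow_two, hs']
  ext <;> simp <;> ring

/-- Representatives for the quotient of the maximal ideal of `O₂` by `2 O₂`. -/
def maximalIdealReps : Set ℍ[ℚ_[2]] :=
  {0, quat 0 1 1 0, quat 0 0 1 1, quat 0 1 0 1}

lemma maximalIdealReps_subset {v : ℍ[ℚ_[2]]} (hv : v ∈ maximalIdealReps) :
    v ∈ maximalIdealQ2 := by
  rcases hv with rfl | rfl | rfl | rfl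
  · exact zero_mem _
  · exact ⟨0, 1, 1, 0, 1, by ext <;> simp, by ring⟩
  · exact ⟨0, 0, 1, 1, 1, by ext <;> simp, by ring⟩
  · exact ⟨0, 1, 0, 1, 1, by ext <;> simp, by ring⟩

lemma exists_rep_of_mem_maximalIdealQ2 {x : ℍ[ℚ_[2]]} (hx : x ∈ maximalIdealQ2) :
    ∃ v ∈ maximalIdealReps, ∃ y ∈ MaximalOrderQ2, x = v + 2 * y := by
  obtain ⟨s, f, g, h, e, rfl, hs⟩ := hx
  obtain rfl : s = 2 * e - f - g - h := by linear_combination hs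
  obtain ⟨f, rfl | rfl⟩ := PadicInt.exists_eq_two_mul_or f <;>
  obtain ⟨g, rfl | rfl⟩ := PadicInt.exists_eq_two_mul_or g <;>
  obtain ⟨h, rfl | rfl⟩ := PadicInt.exists_eq_two_mul_or h
  · refine ⟨0, by simp [maximalIdealReps], _, mem_maximalOrderQ2_iff.2
      ⟨e - f - g - 2 * h, f - h, g - h, 2 * h, rfl⟩, ?_⟩
    ext <;> simp
    ring
  · refine ⟨quat 0 1 1 0, by simp [maximalIdealReps], _, mem_maximalOrderQ2_iff.2
      ⟨e - f - g - 2 * h - 1, f - h - 1, g - h - 1, 2 * h + 1, rfl⟩, ?_⟩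
    ext <;> simp <;> ring
  · refine ⟨quat 0 1 0 1, by simp [maximalIdealReps], _, mem_maximalOrderQ2_iff.2
      ⟨e - f - g - 2 * h, f - h, g - h + 1, 2 * h - 1, rfl⟩, ?_⟩
    ext <;> simp <;> ring
  · refine ⟨quat 0 0 1 1, by simp [maximalIdealReps], _, mem_maximalOrderQ2_iff.2
      ⟨e - f - g - 2 * h - 1, f - h, g - h, 2 * h, rfl⟩, ?_⟩
    ext <;> simp <;> ring
  · refine ⟨quat 0 0 1 1, by simp [maximalIdealReps], _, mem_maximalOrderQ2_iff.2
      ⟨e - f - g - 2 * h, f - h + 1, g - h, 2 * h - 1, rfl⟩, ?_⟩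
    ext <;> simp <;> ring
  · refine ⟨quat 0 1 0 1, by simp [maximalIdealReps], _, mem_maximalOrderQ2_iff.2
      ⟨e - f - g - 2 * h - 1, f - h, g - h, 2 * h, rfl⟩, ?_⟩
    ext <;> simp <;> ring
  · refine ⟨quat 0 1 1 0, by simp [maximalIdealReps], _, mem_maximalOrderQ2_iff.2
      ⟨e - f - g - 1 - 2 * h, f - h, g - h, 2 * h, rfl⟩, ?_⟩
    ext <;> simp <;> ring
  · refine ⟨0, by simp [maximalIdealReps], _, mem_maximalOrderQ2_iff.2
      ⟨e - f - g - 2 * h - 2, f - h, g - h, 2 * h + 1, rfl⟩, ?_⟩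
    ext <;> simp <;> ring

/-- A quaternion with integral coordinates lies in the maximal ideal or is congruent to `1`. -/
lemma mk_intCoords_mem_maximalIdealQ2_or (a b c d : ℤ_[2]) :
    quat (a : ℚ_[2]) b c d ∈ maximalIdealQ2 ∨
      quat (a : ℚ_[2]) b c d - 1 ∈ maximalIdealQ2 := by
  obtain ⟨e, he | he⟩ := PadicInt.exists_eq_two_mul_or (a + b + c + d)
  · exact .inl ⟨a, b, c, d, e, rfl, he⟩
  · exact .inr ⟨a - 1, b, c, d, e, by ext <;> simp, by linear_combination he⟩

lemma one_add_two_pow_mul_mem_or {k : ℕ} (hk : 1 ≤ k) {y : ℍ[ℚ_[2]]} (hy : y ∈ MaximalOrderQ2)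
    (hnorm : normSq (1 + 2 ^ k * y) = 1) : y ∈ maximalIdealQ2 ∨ y - 1 ∈ maximalIdealQ2 := by
  obtain ⟨a, b, c, d, rfl⟩ := mem_maximalOrderQ2_iff.1 hy
  obtain ⟨j, rfl⟩ := Nat.exists_eq_add_of_le' hk
  have hpow : (2 : ℍ[ℚ_[2]]) ^ (j + 1) = ((2 ^ (j + 1) : ℚ_[2]) : ℍ[ℚ_[2]]) := by
    push_cast; rfl
  rw [hpow, Quaternion.coe_mul_eq_smul, normSq_def'] at hnorm
  simp at hnorm
  have htr : (2 : ℚ_[2]) ^ (j + 2) * (2 * a + d +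
      2 * (2 ^ j * (a ^ 2 + b ^ 2 + c ^ 2 + d ^ 2 + a * d + b * d + c * d))) = 0 := by
    linear_combination 2 * hnorm
  have htr' : 2 * a + d +
      2 * (2 ^ j * (a ^ 2 + b ^ 2 + c ^ 2 + d ^ 2 + a * d + b * d + c * d)) = 0 := by
    rw [← PadicInt.coe_eq_zero]
    push_cast
    rw [PadicInt.coe_two]
    exact (mul_eq_zero.1 htr).resolve_left (pow_ne_zero _ two_ne_zero)
  obtain ⟨d, rfl⟩ : ∃ d', d = 2 * d' :=
    ⟨-a - 2 ^ j * (a ^ 2 + b ^ 2 + c ^ 2 + d ^ 2 + a * d + b * d + c * d),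
      by linear_combination htr'⟩
  convert mk_intCoords_mem_maximalIdealQ2_or (a + d) (b + d) (c + d) d using 4 <;> simp

end MaximalOrder

section NormOneElements

variable {ℓ : ℕ}

/-- The coordinatewise inclusion `ℍ[ℚ] → ℍ[ℚ₂]` as a ring homomorphism. -/
noncomputable def iotaQ2Hom : ℍ[ℚ] →+* ℍ[ℚ_[2]] where
  toFun x := quat (x.re : ℚ_[2]) x.imI x.imJ x.imK
  map_one' := by ext <;> simp
  map_zero' := by ext <;> simp
  map_add' x y := by ext <;> simp
  map_mul' x y := by ext <;> simp

lemma normSq_quat {R : Type*} [CommRing R] (a b c d : R) :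
    normSq (quat a b c d) = a ^ 2 + b ^ 2 + c ^ 2 + d ^ 2 :=
  normSq_def' _

lemma smul_one_eq_quat (a : ℚ) : a • (1 : ℍ[ℚ]) = quat a 0 0 0 := by
  rw [← Algebra.algebraMap_eq_smul_one]
  ext <;> simp

lemma normSq_iotaQ2Hom (x : ℍ[ℚ]) : normSq (iotaQ2Hom x) = (normSq x : ℚ) := by
  rw [normSq_def', normSq_def']
  simp [iotaQ2Hom]

lemma iotaQ2Hom_mem_maximalOrderQ2 (hodd : Odd ℓ) {x : ℍ[ℚ]} (hx : x ∈ HurwitzOrderInvLoc ℓ) :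
    iotaQ2Hom x ∈ MaximalOrderQ2 := by
  suffices h : HurwitzOrderInvLoc ℓ ≤ MaximalOrderQ2.comap iotaQ2Hom from h hx
  refine Subring.closure_le.2 (Set.union_subset (SetLike.coe_subset_coe.2
    (Subring.closure_le.2 ?_)) ?_)
  · rintro _ (rfl | rfl | rfl)
    · exact mem_maximalOrderQ2_iff.2 ⟨0, 1, 0, 0, by ext <;> simp [iotaQ2Hom]⟩
    · exact mem_maximalOrderQ2_iff.2 ⟨0, 0, 1, 0, by ext <;> simp [iotaQ2Hom]⟩
    · exact mem_maximalOrderQ2_iff.2 ⟨0, 0, 0, 1, by ext <;> simp [iotaQ2Hom]⟩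
  · rintro _ rfl
    obtain ⟨r, hr⟩ := PadicInt.exists_mul_natCast_eq_one hodd
    have hr' : (r : ℚ_[2]) = (ℓ : ℚ_[2])⁻¹ :=
      eq_inv_of_mul_eq_one_left (by exact_mod_cast congrArg ((↑) : ℤ_[2] → ℚ_[2]) hr)
    exact mem_maximalOrderQ2_iff.2 ⟨r, 0, 0, 0, by
      rw [smul_one_eq_quat]; ext <;> simp [iotaQ2Hom, hr']⟩

variable (ℓ) in
/-- The image in `ℍ[ℚ₂]` of the monoid of norm-one elements of `O[1/ℓ]`. -/
noncomputable def normOneImage : Submonoid ℍ[ℚ_[2]] :=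
  ((HurwitzOrderInvLoc ℓ).toSubmonoid ⊓ MonoidHom.mker (normSq : ℍ[ℚ] →*₀ ℚ)).map iotaQ2Hom

lemma iotaQ2Hom_mem_normOneImage {x : ℍ[ℚ]} (hx : x ∈ HurwitzOrderInvLoc ℓ)
    (hnorm : normSq x = 1) : iotaQ2Hom x ∈ normOneImage ℓ :=
  ⟨x, ⟨hx, hnorm⟩, rfl⟩

lemma mem_maximalOrderQ2_of_mem_normOneImage (hodd : Odd ℓ) {g : ℍ[ℚ_[2]]}
    (hg : g ∈ normOneImage ℓ) : g ∈ MaximalOrderQ2 := by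
  obtain ⟨x, ⟨hx, -⟩, rfl⟩ := hg
  exact iotaQ2Hom_mem_maximalOrderQ2 hodd hx

lemma normSq_of_mem_normOneImage {g : ℍ[ℚ_[2]]} (hg : g ∈ normOneImage ℓ) : normSq g = 1 := by
  obtain ⟨x, ⟨-, hx⟩, rfl⟩ := hg
  rw [normSq_iotaQ2Hom, show normSq x = 1 from hx, Rat.cast_one]

lemma hurwitzOrder_le_hurwitzOrderInvLoc : HurwitzOrder ≤ HurwitzOrderInvLoc ℓ := fun _ hx =>
  Subring.subset_closure (.inl hx)

lemma quat_intCast_mem_hurwitzOrder (w x y z : ℤ) : quat (w : ℚ) x y z ∈ HurwitzOrder := by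
  have hi : quat (0 : ℚ) 1 0 0 ∈ HurwitzOrder := Subring.subset_closure (.inl rfl)
  have hj : quat (0 : ℚ) 0 1 0 ∈ HurwitzOrder := Subring.subset_closure (.inr (.inl rfl))
  convert add_mem (add_mem (intCast_mem HurwitzOrder w) (zsmul_mem hi x))
    (add_mem (zsmul_mem hj y) (zsmul_mem (mul_mem hi hj) z)) using 1
  ext <;> simp

lemma quat_mul_mem_normOneImage {r : ℤ_[2]} (hr : r * ℓ = 1) {w x y z : ℤ}
    (h : w ^ 2 + x ^ 2 + y ^ 2 + z ^ 2 = (ℓ : ℤ) ^ 2) :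
    quat (w * r : ℚ_[2]) (x * r) (y * r) (z * r) ∈ normOneImage ℓ := by
  have hr' : (r : ℚ_[2]) = (ℓ : ℚ_[2])⁻¹ :=
    eq_inv_of_mul_eq_one_left (by exact_mod_cast congrArg ((↑) : ℤ_[2] → ℚ_[2]) hr)
  have hℓ : (ℓ : ℚ) ≠ 0 := by
    rintro h0
    rw [Nat.cast_eq_zero] at h0
    simp [h0] at hr
  have h' : (w : ℚ) ^ 2 + x ^ 2 + y ^ 2 + z ^ 2 = (ℓ : ℚ) ^ 2 := by exact_mod_cast h
  convert iotaQ2Hom_mem_normOneImage (x := ((ℓ : ℚ)⁻¹ • (1 : ℍ[ℚ])) * quat (w : ℚ) x y z)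
    (mul_mem (Subring.subset_closure (.inr rfl))
      (hurwitzOrder_le_hurwitzOrderInvLoc (quat_intCast_mem_hurwitzOrder w x y z))) ?_ using 1
  · rw [smul_one_eq_quat]
    ext <;> simp [iotaQ2Hom, hr', mul_comm]
  · rw [map_mul, normSq_quat, h', Quaternion.normSq_smul]
    simp [hℓ]

lemma quat_intCast_mem_normOneImage {w x y z : ℤ} (h : w ^ 2 + x ^ 2 + y ^ 2 + z ^ 2 = 1) :
    quat (w : ℚ_[2]) x y z ∈ normOneImage ℓ := by
  convert iotaQ2Hom_mem_normOneImage (ℓ := ℓ)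
    (hurwitzOrder_le_hurwitzOrderInvLoc (quat_intCast_mem_hurwitzOrder w x y z)) ?_ using 1
  · ext <;> simp [iotaQ2Hom]
  · rw [normSq_quat]
    exact_mod_cast h

lemma quat_half_mem_normOneImage :
    quat (1 / 2 : ℚ_[2]) (1 / 2) (1 / 2) (1 / 2) ∈ normOneImage ℓ := by
  convert iotaQ2Hom_mem_normOneImage (ℓ := ℓ) (x := quat (1 / 2) (1 / 2) (1 / 2) (1 / 2))
    (hurwitzOrder_le_hurwitzOrderInvLoc (Subring.subset_closure (.inr (.inr rfl)))) ?_ using 1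
  · ext <;> simp [iotaQ2Hom]
  · rw [normSq_quat]
    norm_num

/-- A solution of `(ℓ - 4)² + 4 (b² + c² + d²) = ℓ²` in which
`b` and `c` are odd and `d` is even. -/
lemma exists_sub_four_sq_add_eq_sq (hℓ : 3 ≤ ℓ) (hodd : Odd ℓ) : ∃ m b c d : ℤ,
    (ℓ : ℤ) = 2 * m + 1 ∧
      (2 * m - 3) ^ 2 + (2 * (2 * b + 1)) ^ 2 + (2 * (2 * c + 1)) ^ 2 + (4 * d) ^ 2 =
        (ℓ : ℤ) ^ 2 := by
  obtain ⟨m, rfl⟩ := hodd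
  obtain ⟨x, y, z, h⟩ := exists_sum_three_squares_of_mod_four_eq_two
    (m := 2 * (2 * m + 1) - 4) (by omega)
  replace h : x ^ 2 + y ^ 2 + z ^ 2 = 4 * m - 2 := by
    rw [h]
    omega
  rcases Int.even_or_odd' x with ⟨x, rfl | rfl⟩ <;>
  rcases Int.even_or_odd' y with ⟨y, rfl | rfl⟩ <;>
  rcases Int.even_or_odd' z with ⟨z, rfl | rfl⟩ <;>
  ring_nf at h
  · omega
  · omega
  · omega
  · exact ⟨m, y, z, x, by push_cast; ring, by push_cast; linear_combination 4 * h⟩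
  · omega
  · exact ⟨m, x, z, y, by push_cast; ring, by push_cast; linear_combination 4 * h⟩
  · exact ⟨m, x, y, z, by push_cast; ring, by push_cast; linear_combination 4 * h⟩
  · omega

end NormOneElements

section Approximation

variable {ℓ : ℕ}

lemma mul_two_pow_mul_comm (x y : ℍ[ℚ_[2]]) (k : ℕ) : x * (2 ^ k * y) = 2 ^ k * (x * y) :=
  (((Commute.ofNat_left 2 x).pow_left k).left_comm y).symm

lemma one_add_two_pow_mul_sq (k : ℕ) (z : ℍ[ℚ_[2]]) :
    (1 + 2 ^ (k + 1) * z) ^ 2 = 1 + 2 ^ (k + 2) * (z + 2 ^ k * z ^ 2) := by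
  have h := mul_two_pow_mul_comm z z (k + 1)
  have h2 : (2 : ℍ[ℚ_[2]]) ^ (k + 1) * (2 ^ (k + 1) * (z * z)) =
      2 ^ (k + 2) * (2 ^ k * (z * z)) := by
    rw [← mul_assoc, ← mul_assoc (2 ^ (k + 2)), ← pow_add, ← pow_add]
    congr 2
    ring
  have h3 : (1 + 2 ^ (k + 1) * z) ^ 2 =
      1 + 2 * (2 ^ (k + 1) * z) + 2 ^ (k + 1) * (z * (2 ^ (k + 1) * z)) := by noncomm_ring
  rw [h3, h, h2, pow_two, mul_add, ← mul_assoc 2, ← pow_succ', add_assoc]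

lemma exists_normOneImage_eq_one_add_rep (hℓ : 3 ≤ ℓ) (hodd : Odd ℓ) (k : ℕ) {v : ℍ[ℚ_[2]]}
    (hv : v ∈ maximalIdealReps) :
    ∃ g ∈ normOneImage ℓ, ∃ u ∈ MaximalOrderQ2, g = 1 + 2 ^ k * (v + 2 * u) := by
  match k with
  | 0 =>
    rcases hv with rfl | rfl | rfl | rfl
    · exact ⟨1, one_mem _, 0, zero_mem _, by simp⟩
    · refine ⟨_, quat_intCast_mem_normOneImage (w := 0) (x := 0) (y := 0) (z := 1) (by simp), _,
        mem_maximalOrderQ2_iff.2 ⟨-1, -1, -1, 1, rfl⟩, ?_⟩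
      ext <;> simp <;> ring
    · refine ⟨_, quat_intCast_mem_normOneImage (w := 0) (x := 1) (y := 0) (z := 0) (by simp), _,
        mem_maximalOrderQ2_iff.2 ⟨0, 1, 0, -1, rfl⟩, ?_⟩
      ext <;> simp <;> ring
    · refine ⟨_, quat_intCast_mem_normOneImage (w := 0) (x := 0) (y := 1) (z := 0) (by simp), _,
        mem_maximalOrderQ2_iff.2 ⟨0, 0, 1, -1, rfl⟩, ?_⟩
      ext <;> simp <;> ring
  | 1 =>
    obtain ⟨m, b, c, d, hm, h⟩ := exists_sub_four_sq_add_eq_sq hℓ hodd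
    obtain ⟨r, hr⟩ := PadicInt.exists_mul_natCast_eq_one hodd
    have hr' : (r : ℚ_[2]) * (2 * m + 1) = 1 := by
      rw [show (2 * m + 1 : ℚ_[2]) = ((ℓ : ℤ_[2]) : ℚ_[2]) by
        rw [PadicInt.coe_natCast]; exact_mod_cast (congrArg ((↑) : ℤ → ℚ_[2]) hm).symm]
      exact_mod_cast congrArg ((↑) : ℤ_[2] → ℚ_[2]) hr
    rw [pow_one]
    rcases hv with rfl | rfl | rfl | rfl
    · exact ⟨1, one_mem _, 0, zero_mem _, by simp⟩
    · refine ⟨_, quat_mul_mem_normOneImage hr h, _,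
        mk_intCoords_mem_maximalOrderQ2 (-r) (r * (b - m)) (r * (c - m)) (r * d), ?_⟩
      ext <;> simp
      · linear_combination hr'
      · linear_combination 2 * hr'
      · linear_combination 2 * hr'
      · ring
    · refine ⟨_, quat_mul_mem_normOneImage hr (w := 2 * m - 3) (x := 4 * d) (y := 2 * (2 * b + 1))
        (z := 2 * (2 * c + 1)) (by linear_combination h), _,
        mk_intCoords_mem_maximalOrderQ2 (-r) (r * d) (r * (b - m)) (r * (c - m)), ?_⟩
      ext <;> simp
      · linear_combination hr'
      · ring
      · linear_combination 2 * hr'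
      · linear_combination 2 * hr'
    · refine ⟨_, quat_mul_mem_normOneImage hr (w := 2 * m - 3) (x := 2 * (2 * b + 1)) (y := 4 * d)
        (z := 2 * (2 * c + 1)) (by linear_combination h), _,
        mk_intCoords_mem_maximalOrderQ2 (-r) (r * (b - m)) (r * d) (r * (c - m)), ?_⟩
      ext <;> simp
      · linear_combination hr'
      · linear_combination 2 * hr'
      · ring
      · linear_combination 2 * hr'
  | k + 2 =>
    obtain ⟨g, hg, u, hu, rfl⟩ := exists_normOneImage_eq_one_add_rep hℓ hodd (k + 1) hv
    obtain ⟨t, ht, hsq⟩ := exists_sq_eq_two_mul_of_mem_maximalIdealQ2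
      (add_mem (maximalIdealReps_subset hv) (two_mul_mem_maximalIdealQ2 hu))
    refine ⟨_, pow_mem hg 2, u + 2 ^ k * t,
      add_mem hu (mul_mem (pow_mem (ofNat_mem _ 2) k) ht), ?_⟩
    rw [one_add_two_pow_mul_sq, hsq, ← mul_two_pow_mul_comm 2 t, mul_add 2 u, add_assoc]

lemma exists_normOneImage_eq_one_add_one_add (hℓ : 3 ≤ ℓ) (hodd : Odd ℓ) (k : ℕ) :
    ∃ g ∈ normOneImage ℓ, ∃ p ∈ maximalIdealQ2, g = 1 + 2 ^ (k + 1) * (1 + p) := by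
  match k with
  | 0 =>
    refine ⟨_, quat_intCast_mem_normOneImage (w := -1) (x := 0) (y := 0) (z := 0) (by simp), -2,
      neg_mem (by simpa using two_mul_mem_maximalIdealQ2 (one_mem _)), ?_⟩
    ext <;> simp
    ring
  | 1 =>
    obtain ⟨m, b, c, d, hm, h⟩ := exists_sub_four_sq_add_eq_sq hℓ hodd
    obtain ⟨r, hr⟩ := PadicInt.exists_mul_natCast_eq_one hodd
    have hr' : r * (2 * m + 1) = 1 := by
      have hm' := congrArg ((↑) : ℤ → ℤ_[2]) hm
      push_cast at hm'
      rw [← hm', hr]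
    have hr'' : (r : ℚ_[2]) * (2 * m + 1) = 1 := by
      have := congrArg ((↑) : ℤ_[2] → ℚ_[2]) hr'
      push_cast at this
      exact this
    have h' : (2 * m - 3 : ℚ_[2]) ^ 2 + (2 * (2 * b + 1)) ^ 2 + (2 * (2 * c + 1)) ^ 2 +
        (4 * d) ^ 2 = (2 * m + 1) ^ 2 := by
      rw [hm] at h
      exact_mod_cast h
    refine ⟨_, mul_mem (quat_mul_mem_normOneImage hr h) (quat_mul_mem_normOneImage hr
      (w := 2 * m - 3) (x := -(2 * (2 * b + 1))) (y := 2 * (2 * c + 1)) (z := 4 * d)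
      (by linear_combination h)), _,
      ⟨-2 * ((2 * c + 1) ^ 2 + (2 * d) ^ 2) * r ^ 2 - 1, 0,
        ((2 * c + 1) * (2 * m - 3) - 2 * (2 * b + 1) * (2 * d)) * r ^ 2,
        (2 * d * (2 * m - 3) + 2 * (2 * b + 1) * (2 * c + 1)) * r ^ 2,
        r ^ 2 * (-((2 * c + 1) ^ 2 + (2 * d) ^ 2) + 2 * c * m - 3 * c - m - 2 - 2 * m ^ 2 -
          (2 * b + 1) * (2 * d) + d * (2 * m - 3) + (2 * b + 1) * (2 * c + 1)), rfl, ?_⟩, ?_⟩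
    · linear_combination (r * (2 * m + 1) + 1) * hr'
    · rw [show (2 : ℍ[ℚ_[2]]) ^ (1 + 1) = 2 * 2 from pow_two 2]
      ext <;> simp [show ((3 : ℤ_[2]) : ℚ_[2]) = 3 from rfl]
      · linear_combination (r : ℚ_[2]) ^ 2 * h' + (r * (2 * m + 1) + 1) * hr''
      all_goals ring
  | k + 2 =>
    obtain ⟨g, hg, p, hp, rfl⟩ := exists_normOneImage_eq_one_add_one_add hℓ hodd (k + 1)
    refine ⟨_, pow_mem hg 2, p + 2 ^ (k + 1) * (1 + p) ^ 2, add_mem hp ?_, ?_⟩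
    · rw [pow_succ', mul_assoc]
      exact two_mul_mem_maximalIdealQ2 (mul_mem (pow_mem (ofNat_mem _ 2) k)
        (pow_mem (add_mem (one_mem _) (mem_maximalOrderQ2_of_mem_maximalIdealQ2 hp)) 2))
    · rw [one_add_two_pow_mul_sq, add_assoc 1 p]

lemma star_mul_self_of_normSq_eq_one {g : ℍ[ℚ_[2]]} (h : normSq g = 1) : star g * g = 1 := by
  rw [Quaternion.star_mul_self, h, Quaternion.coe_one]

lemma self_mul_star_of_normSq_eq_one {g : ℍ[ℚ_[2]]} (h : normSq g = 1) : g * star g = 1 := by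
  rw [Quaternion.self_mul_star, h, Quaternion.coe_one]

lemma sub_mul_eq_mul_star_mul_sub {g : ℍ[ℚ_[2]]} (h : normSq g = 1) (x y : ℍ[ℚ_[2]]) :
    x - g * y = g * (star g * x - y) := by
  rw [mul_sub, ← mul_assoc, self_mul_star_of_normSq_eq_one h, one_mul]

lemma star_mul_eq_one_add {g x y : ℍ[ℚ_[2]]} {k : ℕ} (h : normSq g = 1)
    (hxy : x - g = 2 ^ k * y) : star g * x = 1 + 2 ^ k * (star g * y) := by
  rw [← mul_two_pow_mul_comm, ← hxy, mul_sub, star_mul_self_of_normSq_eq_one h]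
  abel

variable {x : ℍ[ℚ_[2]]}

lemma normSq_ne_one_of_mem_maximalIdealQ2 (hx : x ∈ maximalIdealQ2) : normSq x ≠ 1 := by
  obtain ⟨a, b, c, d, e, rfl, h⟩ := hx
  intro hnorm
  refine PadicInt.two_mul_ne_one
    (2 * e ^ 2 - (a * b + a * c + a * d + b * c + b * d + c * d)) ?_
  rw [normSq_quat] at hnorm
  have hnorm' : a ^ 2 + b ^ 2 + c ^ 2 + d ^ 2 = 1 := by
    apply Subtype.ext
    push_cast
    exact hnorm
  linear_combination hnorm' - (a + b + c + d + 2 * e) * h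

lemma exists_normOneImage_sub_mem_maximalIdealQ2 (hx : x ∈ MaximalOrderQ2)
    (hnorm : normSq x = 1) : ∃ g ∈ normOneImage ℓ, x - g ∈ maximalIdealQ2 := by
  obtain ⟨a, b, c, d, rfl⟩ := mem_maximalOrderQ2_iff.1 hx
  obtain ⟨d, rfl | rfl⟩ := PadicInt.exists_eq_two_mul_or d
  · refine ⟨1, one_mem _, ?_⟩
    have hint : quat ((a : ℚ_[2]) + ((2 * d : ℤ_[2]) : ℚ_[2]) / 2)
        (b + ((2 * d : ℤ_[2]) : ℚ_[2]) / 2) (c + ((2 * d : ℤ_[2]) : ℚ_[2]) / 2)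
        (((2 * d : ℤ_[2]) : ℚ_[2]) / 2) =
        quat (((a + d : ℤ_[2]) : ℚ_[2])) ((b + d : ℤ_[2]) : ℚ_[2]) ((c + d : ℤ_[2]) : ℚ_[2]) d := by
      ext <;> simp
    rw [hint] at hnorm ⊢
    refine (mk_intCoords_mem_maximalIdealQ2_or _ _ _ _).resolve_left fun h => ?_
    exact normSq_ne_one_of_mem_maximalIdealQ2 h hnorm
  · have hint : quat ((a : ℚ_[2]) + ((2 * d + 1 : ℤ_[2]) : ℚ_[2]) / 2)
        (b + ((2 * d + 1 : ℤ_[2]) : ℚ_[2]) / 2) (c + ((2 * d + 1 : ℤ_[2]) : ℚ_[2]) / 2)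
        (((2 * d + 1 : ℤ_[2]) : ℚ_[2]) / 2) =
        quat (((a + d : ℤ_[2]) : ℚ_[2])) ((b + d : ℤ_[2]) : ℚ_[2]) ((c + d : ℤ_[2]) : ℚ_[2]) d +
          quat (1 / 2) (1 / 2) (1 / 2) (1 / 2) := by
      ext <;> simp <;> ring
    rw [hint]
    rcases mk_intCoords_mem_maximalIdealQ2_or (a + d) (b + d) (c + d) d with h | h
    · exact ⟨_, quat_half_mem_normOneImage, by rwa [add_sub_cancel_right]⟩
    · refine ⟨_, pow_mem quat_half_mem_normOneImage 2, ?_⟩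
      convert add_mem h (two_mul_mem_maximalIdealQ2 (one_mem _)) using 1
      rw [pow_two]
      ext <;> simp <;> ring

lemma exists_normOneImage_sub_eq_two_pow_succ_mul (hℓ : 3 ≤ ℓ) (hodd : Odd ℓ) {k : ℕ}
    (h : ∃ g ∈ normOneImage ℓ, ∃ p ∈ maximalIdealQ2, x - g = 2 ^ k * p) :
    ∃ g ∈ normOneImage ℓ, ∃ y ∈ MaximalOrderQ2, x - g = 2 ^ (k + 1) * y := by
  obtain ⟨g, hg, p, hp, hxg⟩ := h
  have hg1 := normSq_of_mem_normOneImage hg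
  have hgO := mem_maximalOrderQ2_of_mem_normOneImage hodd hg
  obtain ⟨v, hv, y, hy, hvy⟩ := exists_rep_of_mem_maximalIdealQ2
    (mul_mem_maximalIdealQ2 (star_mem_maximalOrderQ2 hgO) hp)
  obtain ⟨h, hh, u, hu, rfl⟩ := exists_normOneImage_eq_one_add_rep hℓ hodd k hv
  refine ⟨_, mul_mem hg hh, g * (y - u), mul_mem hgO (sub_mem hy hu), ?_⟩
  rw [sub_mul_eq_mul_star_mul_sub hg1, star_mul_eq_one_add hg1 hxg, hvy,
    ← mul_two_pow_mul_comm g (y - u), add_sub_add_left_eq_sub, ← mul_sub, add_sub_add_left_eq_sub,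
    ← mul_sub, pow_succ, mul_assoc]

lemma exists_normOneImage_sub_eq_two_pow_mul_maximalIdeal (hℓ : 3 ≤ ℓ) (hodd : Odd ℓ)
    (hnorm : normSq x = 1) {k : ℕ}
    (h : ∃ g ∈ normOneImage ℓ, ∃ y ∈ MaximalOrderQ2, x - g = 2 ^ (k + 1) * y) :
    ∃ g ∈ normOneImage ℓ, ∃ p ∈ maximalIdealQ2, x - g = 2 ^ (k + 1) * p := by
  obtain ⟨g, hg, y, hy, hxg⟩ := h
  have hg1 := normSq_of_mem_normOneImage hg
  have hgO := mem_maximalOrderQ2_of_mem_normOneImage hodd hg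
  have hstar := star_mul_eq_one_add hg1 hxg
  rcases one_add_two_pow_mul_mem_or (Nat.le_add_left 1 k)
    (mul_mem (star_mem_maximalOrderQ2 hgO) hy)
    (by rw [← hstar, map_mul, normSq_star, hg1, hnorm, one_mul]) with hmem | hmem
  · refine ⟨g, hg, g * (star g * y), mul_mem_maximalIdealQ2 hgO hmem, ?_⟩
    rw [hxg, ← mul_assoc g, self_mul_star_of_normSq_eq_one hg1, one_mul]
  · obtain ⟨h, hh, p, hp, rfl⟩ := exists_normOneImage_eq_one_add_one_add hℓ hodd k
    refine ⟨_, mul_mem hg hh, g * (star g * y - 1 - p),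
      mul_mem_maximalIdealQ2 hgO (sub_mem hmem hp), ?_⟩
    rw [sub_mul_eq_mul_star_mul_sub hg1, hstar, ← mul_two_pow_mul_comm g (_ - _ - p),
      add_sub_add_left_eq_sub, ← mul_sub, sub_sub]

lemma exists_normOneImage_sub_eq_two_pow_mul (hℓ : 3 ≤ ℓ) (hodd : Odd ℓ)
    (hx : x ∈ MaximalOrderQ2) (hnorm : normSq x = 1) (k : ℕ) :
    ∃ g ∈ normOneImage ℓ, ∃ p ∈ maximalIdealQ2, x - g = 2 ^ k * p := by
  induction k with
  | zero =>
    obtain ⟨g, hg, h⟩ := exists_normOneImage_sub_mem_maximalIdealQ2 hx hnorm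
    exact ⟨g, hg, _, h, by simp⟩
  | succ k ih =>
    exact exists_normOneImage_sub_eq_two_pow_mul_maximalIdeal hℓ hodd hnorm
      (exists_normOneImage_sub_eq_two_pow_succ_mul hℓ hodd ih)

end Approximation

/-- **Density of `Γ¹` in `Sl₂` at `p = 2`.**  For odd `ℓ ≥ 3`, every norm-one element of
`O₂` is approximated `2`-adically to arbitrary precision by norm-one elements of
`O[1/ℓ]`. -/
theorem gamma1_dense_in_Sl2 (ℓ : ℕ) (hℓ : 3 ≤ ℓ) (hodd : Odd ℓ)
    (x : ℍ[ℚ_[2]]) (hx : x ∈ MaximalOrderQ2) (hnorm : normSq x = 1) (n : ℕ) :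
    ∃ γ : ℍ[ℚ], γ ∈ HurwitzOrderInvLoc ℓ ∧ normSq γ = 1 ∧
      ∃ y ∈ MaximalOrderQ2, x - iotaQ2 γ = 2 ^ n * y := by
  obtain ⟨_, ⟨γ, ⟨hγ, hγ1⟩, rfl⟩, p, hp, h⟩ :=
    exists_normOneImage_sub_eq_two_pow_mul hℓ hodd hx hnorm n
  exact ⟨γ, hγ, hγ1, p, mem_maximalOrderQ2_of_mem_maximalIdealQ2 hp, h⟩
end

section
/- Let B = (-1,-3/ℚ) be the quaternion algebra over ℚ with i² = -1, j² = -3, k = ij, let O be the subring of B generated by i, (1+j)/2, and (i+k)/2 (a maximal order, isomorphic to the endomorphism ring of a supersingular elliptic curve in characteristic 3), and let O[1/2] be the subring of B generated by O and 1/2. Let B₃ = (-1,-3/ℚ₃) be the corresponding quaternion algebra over the 3-adic field ℚ₃, O₃ the subring of B₃ generated by the 3-adic integers ℤ₃ together with i, (1+j)/2, and (i+k)/2 (a maximal order, whose unit group is the second Morava stabilizer group at p = 3), and ι : B → B₃ the ring homomorphism applying the inclusion ℚ → ℚ₃ to each coordinate. Then for every unit x of O₃ and every natural number n, there exists γ ∈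 B such that γ ∈ O[1/2], normSq(γ) = 2^k for some integer k ∈ ℤ, and x - ι(γ) ∈ 3ⁿ·O₃ (i.e. x - ι(γ) = 3ⁿ·y for some y ∈ O₃). (This expresses that, at p = 3 with ℓ = 2 a topological generator of ℤ₃ˣ, the group Γ of quasi-endomorphisms of degree a power of 2 is dense in the second Morava stabilizer group 𝕊₂.) -/
open Quaternion

/-- The reduced norm on the quaternion algebra `(-1,-3/ℚ)`. -/
def normSqB (x : ℍ[ℚ, -1, -3]) : ℚ := (x * star x).re

/-- The maximal order `O` of `B = (-1,-3/ℚ)` generated by `i`, `(1+j)/2` and `(i+k)/2`;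
it is isomorphic to the endomorphism ring of a supersingular elliptic curve in
characteristic `3`. -/
noncomputable def MaximalOrderB : Subring ℍ[ℚ, -1, -3] :=
  Subring.closure {(⟨0, 1, 0, 0⟩ : ℍ[ℚ, -1, -3]), ⟨1/2, 0, 1/2, 0⟩, ⟨0, 1/2, 0, 1/2⟩}

/-- `O[1/2]`: the subring of `B` generated by `O` and `1/2`. -/
noncomputable def MaximalOrderBInvTwo : Subring ℍ[ℚ, -1, -3] :=
  Subring.closure ((MaximalOrderB : Set ℍ[ℚ, -1, -3]) ∪ {(⟨1/2, 0, 0, 0⟩ : ℍ[ℚ, -1, -3])})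

/-- The maximal order `O₃` of `B₃ = (-1,-3/ℚ₃)`: the subring generated by `ℤ₃`, `i`,
`(1+j)/2` and `(i+k)/2`.  Its unit group is the second Morava stabilizer group at
`p = 3`. -/
noncomputable def MaximalOrderB3 : Subring ℍ[ℚ_[3], -1, -3] :=
  Subring.closure
    ({(⟨0, 1, 0, 0⟩ : ℍ[ℚ_[3], -1, -3]), ⟨1/2, 0, 1/2, 0⟩, ⟨0, 1/2, 0, 1/2⟩} ∪
      {x : ℍ[ℚ_[3], -1, -3] | ∃ z : ℤ_[3], x = algebraMap ℚ_[3] ℍ[ℚ_[3], -1, -3] (z : ℚ_[3])})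

/-- The coordinatewise inclusion `B → B₃`. -/
noncomputable def iotaB : ℍ[ℚ, -1, -3] → ℍ[ℚ_[3], -1, -3] :=
  fun x => ⟨(x.re : ℚ_[3]), (x.imI : ℚ_[3]), (x.imJ : ℚ_[3]), (x.imK : ℚ_[3])⟩

section Coordinates

variable {K : Type*} [Field K]

/-- The quaternion `a + b i + c (1+j)/2 + d (i+k)/2`. -/
def ofCoords (a b c d : K) : ℍ[K, -1, -3] := ⟨a + c / 2, b + d / 2, c / 2, d / 2⟩

/-- The norm form of `(-1,-3/K)` in the coordinates `1, i, j, k`. -/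
def normForm (x : ℍ[K, -1, -3]) : K :=
  x.re ^ 2 + x.imI ^ 2 + 3 * x.imJ ^ 2 + 3 * x.imK ^ 2

lemma normForm_mul (x y : ℍ[K, -1, -3]) : normForm (x * y) = normForm x * normForm y := by
  simp only [normForm, QuaternionAlgebra.re_mul, QuaternionAlgebra.imI_mul,
    QuaternionAlgebra.imJ_mul, QuaternionAlgebra.imK_mul]
  ring

lemma normForm_star (x : ℍ[K, -1, -3]) : normForm (star x) = normForm x := by
  simp [normForm]

lemma normForm_algebraMap (r : K) : normForm (algebraMap K ℍ[K, -1, -3] r) = r ^ 2 := by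
  simp [normForm, QuaternionAlgebra.algebraMap_eq]

lemma mul_star_eq_normForm (x : ℍ[K, -1, -3]) :
    x * star x = algebraMap K ℍ[K, -1, -3] (normForm x) := by
  ext <;> simp [normForm, QuaternionAlgebra.algebraMap_eq] <;> ring

lemma star_mul_eq_normForm (x : ℍ[K, -1, -3]) :
    star x * x = algebraMap K ℍ[K, -1, -3] (normForm x) := by
  ext <;> simp [normForm, QuaternionAlgebra.algebraMap_eq] <;> ring

lemma ofCoords_add (a b c d a' b' c' d' : K) :
    ofCoords a b c d + ofCoords a' b' c' d' = ofCoords (a + a') (b + b') (c + c') (d + d') := by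
  ext <;> simp [ofCoords] <;> ring

lemma neg_ofCoords (a b c d : K) : -ofCoords a b c d = ofCoords (-a) (-b) (-c) (-d) := by
  ext <;> simp [ofCoords] <;> ring

lemma algebraMap_mul_ofCoords (r a b c d : K) :
    algebraMap K ℍ[K, -1, -3] r * ofCoords a b c d = ofCoords (r * a) (r * b) (r * c) (r * d) := by
  ext <;> simp [ofCoords, QuaternionAlgebra.algebraMap_eq] <;> ring

lemma ofCoords_mul [CharZero K] (a b c d a' b' c' d' : K) :
    ofCoords a b c d * ofCoords a' b' c' d' =
      ofCoords (a * a' - c * c' - (b + d) * b' - d * d')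
        ((a + c) * b' + c * d' + b * a' - d * c')
        (a * c' + c * a' + c * c' - (b + d) * d' + d * b' + d * d')
        ((a + c) * d' - c * b' - c * d' + b * c' + d * a' + d * c') := by
  ext <;> simp [ofCoords] <;> ring

lemma normForm_ofCoords [CharZero K] (a b c d : K) :
    normForm (ofCoords a b c d) = a ^ 2 + a * c + c ^ 2 + b ^ 2 + b * d + d ^ 2 := by
  simp only [normForm, ofCoords]
  ring

lemma ofCoords_mem [CharZero K] {S : Subring ℍ[K, -1, -3]}
    (hi : (⟨0, 1, 0, 0⟩ : ℍ[K, -1, -3]) ∈ S) (hζ : (⟨1/2, 0, 1/2, 0⟩ : ℍ[K, -1, -3]) ∈ S)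
    (hη : (⟨0, 1/2, 0, 1/2⟩ : ℍ[K, -1, -3]) ∈ S) {a b c d : K}
    (ha : algebraMap K ℍ[K, -1, -3] a ∈ S) (hb : algebraMap K ℍ[K, -1, -3] b ∈ S)
    (hc : algebraMap K ℍ[K, -1, -3] c ∈ S) (hd : algebraMap K ℍ[K, -1, -3] d ∈ S) :
    ofCoords a b c d ∈ S := by
  have h : ofCoords a b c d = algebraMap K ℍ[K, -1, -3] a
      + algebraMap K ℍ[K, -1, -3] b * ⟨0, 1, 0, 0⟩
      + algebraMap K ℍ[K, -1, -3] c * ⟨1/2, 0, 1/2, 0⟩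
      + algebraMap K ℍ[K, -1, -3] d * ⟨0, 1/2, 0, 1/2⟩ := by
    ext <;> simp [ofCoords, QuaternionAlgebra.algebraMap_eq] <;> ring
  rw [h]
  exact add_mem (add_mem (add_mem ha (mul_mem hb hi)) (mul_mem hc hζ)) (mul_mem hd hη)

end Coordinates

lemma ofCoords_mem_maximalOrderB3 (a b c d : ℤ_[3]) :
    ofCoords (a : ℚ_[3]) b c d ∈ MaximalOrderB3 := by
  have h (z : ℤ_[3]) : algebraMap ℚ_[3] ℍ[ℚ_[3], -1, -3] z ∈ MaximalOrderB3 :=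
    Subring.subset_closure (Or.inr ⟨z, rfl⟩)
  exact ofCoords_mem (Subring.subset_closure (by simp)) (Subring.subset_closure (by simp))
    (Subring.subset_closure (by simp)) (h a) (h b) (h c) (h d)

lemma exists_ofCoords_of_mem_maximalOrderB3 {x : ℍ[ℚ_[3], -1, -3]} (hx : x ∈ MaximalOrderB3) :
    ∃ a b c d : ℤ_[3], x = ofCoords (a : ℚ_[3]) b c d := by
  induction hx using Subring.closure_induction with
  | mem x hx =>
    rcases hx with (rfl | rfl | rfl) | ⟨z, rfl⟩
    · exact ⟨0, 1, 0, 0, by ext <;> simp [ofCoords]⟩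
    · exact ⟨0, 0, 1, 0, by ext <;> simp [ofCoords]⟩
    · exact ⟨0, 0, 0, 1, by ext <;> simp [ofCoords]⟩
    · exact ⟨z, 0, 0, 0, by ext <;> simp [ofCoords, QuaternionAlgebra.algebraMap_eq]⟩
  | zero => exact ⟨0, 0, 0, 0, by ext <;> simp [ofCoords]⟩
  | one => exact ⟨1, 0, 0, 0, by ext <;> simp [ofCoords]⟩
  | add x y _ _ hx hy =>
    obtain ⟨a, b, c, d, rfl⟩ := hx
    obtain ⟨a', b', c', d', rfl⟩ := hy
    exact ⟨a + a', b + b', c + c', d + d', by rw [ofCoords_add]; push_cast; rfl⟩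
  | neg x _ hx =>
    obtain ⟨a, b, c, d, rfl⟩ := hx
    exact ⟨-a, -b, -c, -d, by rw [neg_ofCoords]; push_cast; rfl⟩
  | mul x y _ _ hx hy =>
    obtain ⟨a, b, c, d, rfl⟩ := hx
    obtain ⟨a', b', c', d', rfl⟩ := hy
    exact ⟨a * a' - c * c' - (b + d) * b' - d * d', (a + c) * b' + c * d' + b * a' - d * c',
      a * c' + c * a' + c * c' - (b + d) * d' + d * b' + d * d',
      (a + c) * d' - c * b' - c * d' + b * c' + d * a' + d * c',
      by rw [ofCoords_mul]; push_cast; rfl⟩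

lemma ofCoords_intCast_mem_maximalOrderB (a b c d : ℤ) :
    ofCoords (a : ℚ) b c d ∈ MaximalOrderB := by
  have h (z : ℤ) : algebraMap ℚ ℍ[ℚ, -1, -3] z ∈ MaximalOrderB := by
    rw [map_intCast]; exact intCast_mem _ z
  exact ofCoords_mem (Subring.subset_closure (by simp)) (Subring.subset_closure (by simp))
    (Subring.subset_closure (by simp)) (h a) (h b) (h c) (h d)

lemma maximalOrderB_le : MaximalOrderB ≤ MaximalOrderBInvTwo :=
  fun _ hx ↦ Subring.subset_closure (Or.inl hx)

lemma normSqB_eq_normForm (x : ℍ[ℚ, -1, -3]) : normSqB x = normForm x := by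
  rw [normSqB, mul_star_eq_normForm, QuaternionAlgebra.algebraMap_eq]

lemma star_mem_maximalOrderB {x : ℍ[ℚ, -1, -3]} (hx : x ∈ MaximalOrderB) :
    star x ∈ MaximalOrderB := by
  induction hx using Subring.closure_induction with
  | mem x hx =>
    rcases hx with rfl | rfl | rfl
    · convert ofCoords_intCast_mem_maximalOrderB 0 (-1) 0 0 using 1
      ext <;> simp [ofCoords]
    · convert ofCoords_intCast_mem_maximalOrderB 1 0 (-1) 0 using 1
      ext <;> norm_num [ofCoords]
    · convert ofCoords_intCast_mem_maximalOrderB 0 0 0 (-1) using 1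
      ext <;> norm_num [ofCoords]
  | zero => simp
  | one => simp
  | add x y _ _ hx hy => rw [star_add]; exact add_mem hx hy
  | neg x _ hx => rw [star_neg]; exact neg_mem hx
  | mul x y _ _ hx hy => rw [star_mul]; exact mul_mem hy hx

lemma star_mem_maximalOrderBInvTwo {x : ℍ[ℚ, -1, -3]} (hx : x ∈ MaximalOrderBInvTwo) :
    star x ∈ MaximalOrderBInvTwo := by
  induction hx using Subring.closure_induction with
  | mem x hx =>
    rcases hx with hx | rfl
    · exact maximalOrderB_le (star_mem_maximalOrderB hx)
    · refine Subring.subset_closure (Or.inr ?_)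
      rw [Set.mem_singleton_iff]
      ext <;> simp
  | zero => simp
  | one => simp
  | add x y _ _ hx hy => rw [star_add]; exact add_mem hx hy
  | neg x _ hx => rw [star_neg]; exact neg_mem hx
  | mul x y _ _ hx hy => rw [star_mul]; exact mul_mem hy hx

lemma two_zpow_mem_maximalOrderBInvTwo (k : ℤ) :
    algebraMap ℚ ℍ[ℚ, -1, -3] (2 ^ k) ∈ MaximalOrderBInvTwo := by
  obtain ⟨n, rfl | rfl⟩ := k.eq_nat_or_neg
  · rw [zpow_natCast, map_pow, map_ofNat]
    exact pow_mem (ofNat_mem _ 2) n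
  · rw [zpow_neg, zpow_natCast, ← inv_pow, map_pow]
    have h : algebraMap ℚ ℍ[ℚ, -1, -3] 2⁻¹ ∈ MaximalOrderBInvTwo :=
      Subring.subset_closure (Or.inr (by simp [QuaternionAlgebra.algebraMap_eq]))
    exact pow_mem h n

/-- The monoid `Γ` of elements of `O[1/2]` whose reduced norm is a power of `2`. -/
def Gamma : Submonoid ℍ[ℚ, -1, -3] where
  carrier := {γ | γ ∈ MaximalOrderBInvTwo ∧ ∃ k : ℤ, normForm γ = 2 ^ k}
  one_mem' := ⟨one_mem _, 0, by simp [normForm]⟩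
  mul_mem' := by
    rintro x y ⟨hx, k, hk⟩ ⟨hy, l, hl⟩
    exact ⟨mul_mem hx hy, k + l, by rw [normForm_mul, hk, hl, zpow_add₀ two_ne_zero]⟩

lemma Gamma.exists_inv {γ : ℍ[ℚ, -1, -3]} (hγ : γ ∈ Gamma) :
    ∃ δ ∈ Gamma, γ * δ = 1 ∧ δ * γ = 1 := by
  obtain ⟨hγ, k, hk⟩ := hγ
  have h2 : (2 : ℚ) ^ (-k) * 2 ^ k = 1 := by rw [← zpow_add₀ two_ne_zero]; simp
  refine ⟨algebraMap ℚ _ (2 ^ (-k)) * star γ,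
    ⟨mul_mem (two_zpow_mem_maximalOrderBInvTwo _) (star_mem_maximalOrderBInvTwo hγ), -k, ?_⟩, ?_, ?_⟩
  · rw [normForm_mul, normForm_star, hk, normForm_algebraMap, pow_two, mul_assoc, h2, mul_one]
  · rw [← mul_assoc, ← Algebra.commutes, mul_assoc, mul_star_eq_normForm, hk, ← map_mul, h2,
      map_one]
  · rw [mul_assoc, star_mul_eq_normForm, hk, ← map_mul, h2, map_one]

lemma ofCoords_intCast_mem_Gamma {a b c d : ℤ} (m : ℕ)
    (h : a ^ 2 + a * c + c ^ 2 + b ^ 2 + b * d + d ^ 2 = 2 ^ m) :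
    ofCoords (a : ℚ) b c d ∈ Gamma :=
  ⟨maximalOrderB_le (ofCoords_intCast_mem_maximalOrderB a b c d), m, by
    rw [normForm_ofCoords]; exact_mod_cast h⟩

/-- The inclusion `iotaB : B → B₃` as a ring homomorphism. -/
noncomputable def iotaHom : ℍ[ℚ, -1, -3] →+* ℍ[ℚ_[3], -1, -3] where
  toFun := iotaB
  map_zero' := by ext <;> simp [iotaB]
  map_one' := by ext <;> simp [iotaB]
  map_add' x y := by ext <;> simp [iotaB]
  map_mul' x y := by ext <;> simp [iotaB]

lemma iotaHom_ofCoords (a b c d : ℤ) :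
    iotaHom (ofCoords (a : ℚ) b c d) = ofCoords ((a : ℤ_[3]) : ℚ_[3]) (b : ℤ_[3]) (c : ℤ_[3])
      (d : ℤ_[3]) := by
  ext <;> simp [iotaHom, iotaB, ofCoords]

lemma padicInt_coe_ofNat (n : ℕ) [n.AtLeastTwo] :
    ((ofNat(n) : ℤ_[3]) : ℚ_[3]) = ofNat(n) :=
  PadicInt.coe_natCast n

lemma exists_padicInt_eq_half : ∃ z : ℤ_[3], (z : ℚ_[3]) = 1 / 2 := by
  obtain ⟨u, hu⟩ : IsUnit (2 : ℤ_[3]) := by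
    rw [PadicInt.isUnit_iff]
    exact_mod_cast PadicInt.norm_natCast_eq_one_iff.2 (by decide : Nat.Coprime 3 2)
  refine ⟨(u⁻¹ : ℤ_[3]ˣ), ?_⟩
  have h : ((u⁻¹ : ℤ_[3]ˣ) : ℤ_[3]) * 2 = 1 := by rw [← hu, Units.inv_mul]
  have h' := congr_arg ((↑) : ℤ_[3] → ℚ_[3]) h
  rw [PadicInt.coe_mul, padicInt_coe_ofNat, PadicInt.coe_one] at h'
  linear_combination h' / 2

lemma iotaHom_mem_maximalOrderB3 {x : ℍ[ℚ, -1, -3]} (hx : x ∈ MaximalOrderBInvTwo) :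
    iotaHom x ∈ MaximalOrderB3 := by
  suffices h : MaximalOrderBInvTwo ≤ MaximalOrderB3.comap iotaHom from h hx
  refine Subring.closure_le.2 (Set.union_subset ?_ ?_)
  · refine Subring.closure_le.2 ?_
    rintro _ (rfl | rfl | rfl) <;> refine Subring.subset_closure (Or.inl ?_) <;>
      simp [iotaHom, iotaB]
  · rintro _ rfl
    obtain ⟨z, hz⟩ := exists_padicInt_eq_half
    refine Subring.subset_closure (Or.inr ⟨z, ?_⟩)
    rw [hz]
    ext <;> simp [iotaHom, iotaB, QuaternionAlgebra.algebraMap_eq]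

/-- `x` is congruent modulo `3ⁿ O₃` to an element of `Γ`. -/
def Approx (n : ℕ) (x : ℍ[ℚ_[3], -1, -3]) : Prop :=
  ∃ γ ∈ Gamma, ∃ y ∈ MaximalOrderB3, x = iotaHom γ + 3 ^ n * y

lemma three_pow_mul_comm (n : ℕ) (x y : ℍ[ℚ_[3], -1, -3]) : x * (3 ^ n * y) = 3 ^ n * (x * y) := by
  have h : Commute x (3 ^ n) := (Commute.ofNat_right x 3).pow_right n
  rw [← mul_assoc, h.eq, mul_assoc]

lemma Approx.of_congr {n : ℕ} {x x' y : ℍ[ℚ_[3], -1, -3]} (hx : Approx n x)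
    (hy : y ∈ MaximalOrderB3) (h : x' = x + 3 ^ n * y) : Approx n x' := by
  obtain ⟨γ, hγ, z, hz, rfl⟩ := hx
  exact ⟨γ, hγ, z + y, add_mem hz hy, by rw [h, mul_add, add_assoc]⟩

lemma Gamma.iotaHom_mem {γ : ℍ[ℚ, -1, -3]} (hγ : γ ∈ Gamma) : iotaHom γ ∈ MaximalOrderB3 :=
  iotaHom_mem_maximalOrderB3 hγ.1

lemma three_pow_mem (n : ℕ) : (3 ^ n : ℍ[ℚ_[3], -1, -3]) ∈ MaximalOrderB3 :=
  pow_mem (ofNat_mem _ 3) n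

lemma Approx.mul {n : ℕ} {x x' : ℍ[ℚ_[3], -1, -3]} (hx : Approx n x) (hx' : Approx n x') :
    Approx n (x * x') := by
  obtain ⟨γ, hγ, y, hy, rfl⟩ := hx
  obtain ⟨γ', hγ', y', hy', rfl⟩ := hx'
  refine ⟨γ * γ', mul_mem hγ hγ', iotaHom γ * y' + y * iotaHom γ' + y * (3 ^ n * y'), ?_, ?_⟩
  · exact add_mem (add_mem (mul_mem (Gamma.iotaHom_mem hγ) hy')
      (mul_mem hy (Gamma.iotaHom_mem hγ'))) (mul_mem hy (mul_mem (three_pow_mem n) hy'))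
  · rw [map_mul, add_mul, mul_add, mul_add, three_pow_mul_comm n (iotaHom γ)]
    simp only [mul_add, mul_assoc, add_assoc]

/-- If `x ≡ γ` modulo `3ⁿ` then `x = γ (1 + 3ⁿ y)` with `y ∈ O₃`. -/
lemma Approx.exists_factor {n : ℕ} {x : ℍ[ℚ_[3], -1, -3]} (hx : Approx n x) :
    ∃ γ ∈ Gamma, ∃ y ∈ MaximalOrderB3, x = iotaHom γ * (1 + 3 ^ n * y) := by
  obtain ⟨γ, hγ, y, hy, rfl⟩ := hx
  obtain ⟨δ, hδ, hγδ, -⟩ := Gamma.exists_inv hγ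
  refine ⟨γ, hγ, iotaHom δ * y, mul_mem (Gamma.iotaHom_mem hδ) hy, ?_⟩
  rw [mul_add, mul_one, three_pow_mul_comm, ← mul_assoc (iotaHom γ), ← map_mul, hγδ, map_one,
    one_mul]

lemma approx_iotaHom (n : ℕ) {γ : ℍ[ℚ, -1, -3]} (hγ : γ ∈ Gamma) : Approx n (iotaHom γ) :=
  ⟨γ, hγ, 0, zero_mem _, by simp⟩

lemma exists_padicInt_eq_add_three_mul (a : ℤ_[3]) :
    ∃ m : ℕ, m < 3 ∧ ∃ b : ℤ_[3], a = m + 3 * b := by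
  obtain ⟨m, hm, h⟩ := PadicInt.exists_mem_range a
  rw [PadicInt.maximalIdeal_eq_span_p, Ideal.mem_span_singleton] at h
  obtain ⟨b, hb⟩ := h
  exact ⟨m, hm, b, by rw [sub_eq_iff_eq_add'] at hb; exact_mod_cast hb⟩

lemma exists_padicInt_eq_int_add_three_mul (a : ℤ_[3]) :
    ∃ m ∈ Finset.Icc (-1 : ℤ) 1, ∃ b : ℤ_[3], a = m + 3 * b := by
  obtain ⟨m, hm, b, rfl⟩ := exists_padicInt_eq_add_three_mul a
  interval_cases m
  · exact ⟨0, by decide, b, by simp⟩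
  · exact ⟨1, by decide, b, by simp⟩
  · exact ⟨-1, by decide, b + 1, by push_cast; ring⟩

/-- The additive monoid of `y ∈ O₃` such that `1 + 3 y` is congruent to an element of `Γ`
modulo `9`. -/
noncomputable def levelTwo : AddSubmonoid ℍ[ℚ_[3], -1, -3] where
  carrier := {y | y ∈ MaximalOrderB3 ∧ Approx 2 (1 + 3 * y)}
  zero_mem' := ⟨zero_mem _, by simpa using approx_iotaHom 2 (one_mem Gamma)⟩
  add_mem' := by
    rintro y z ⟨hy, hy'⟩ ⟨hz, hz'⟩
    refine ⟨add_mem hy hz, (hy'.mul hz').of_congr (neg_mem (mul_mem hy hz)) ?_⟩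
    have h := three_pow_mul_comm 1 y z
    rw [pow_one] at h
    simp only [add_mul, mul_add, mul_one, one_mul, mul_assoc, h]
    noncomm_ring

lemma add_three_mul_mem_levelTwo {y z : ℍ[ℚ_[3], -1, -3]} (hy : y ∈ levelTwo)
    (hz : z ∈ MaximalOrderB3) : y + 3 * z ∈ levelTwo :=
  ⟨add_mem hy.1 (mul_mem (ofNat_mem _ 3) hz), hy.2.of_congr hz (by noncomm_ring)⟩

lemma algebraMap_mul_mem_levelTwo (a : ℤ_[3]) {y : ℍ[ℚ_[3], -1, -3]} (hy : y ∈ levelTwo) :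
    algebraMap ℚ_[3] ℍ[ℚ_[3], -1, -3] a * y ∈ levelTwo := by
  obtain ⟨m, -, b, rfl⟩ := exists_padicInt_eq_add_three_mul a
  have hb : algebraMap ℚ_[3] ℍ[ℚ_[3], -1, -3] b ∈ MaximalOrderB3 :=
    Subring.subset_closure (Or.inr ⟨b, rfl⟩)
  convert add_three_mul_mem_levelTwo (nsmul_mem hy m) (mul_mem hb hy.1) using 1
  rw [PadicInt.coe_add, PadicInt.coe_mul, PadicInt.coe_natCast, padicInt_coe_ofNat, map_add,
    map_mul, map_natCast, map_ofNat, add_mul, nsmul_eq_mul, mul_assoc]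

lemma ofCoords_mem_levelTwo {a b c d : ℤ} (m : ℕ)
    (h : (1 + 3 * a) ^ 2 + (1 + 3 * a) * (3 * c) + (3 * c) ^ 2 + (3 * b) ^ 2 + (3 * b) * (3 * d)
      + (3 * d) ^ 2 = 2 ^ m) :
    ofCoords ((a : ℤ_[3]) : ℚ_[3]) (b : ℤ_[3]) (c : ℤ_[3]) (d : ℤ_[3]) ∈ levelTwo := by
  refine ⟨ofCoords_mem_maximalOrderB3 _ _ _ _, ?_⟩
  convert approx_iotaHom 2 (ofCoords_intCast_mem_Gamma m h) using 1
  rw [iotaHom_ofCoords, ← map_ofNat (algebraMap ℚ_[3] ℍ[ℚ_[3], -1, -3]) 3,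
    algebraMap_mul_ofCoords]
  ext <;> simp [ofCoords, padicInt_coe_ofNat]; ring

lemma mem_levelTwo {y : ℍ[ℚ_[3], -1, -3]} (hy : y ∈ MaximalOrderB3) : y ∈ levelTwo := by
  obtain ⟨a, b, c, d, rfl⟩ := exists_ofCoords_of_mem_maximalOrderB3 hy
  have h₁ := ofCoords_mem_levelTwo (a := 1) (b := 0) (c := 0) (d := 0) 4 (by norm_num)
  have h₂ := ofCoords_mem_levelTwo (a := 0) (b := 1) (c := -1) (d := 0) 4 (by norm_num)
  have h₃ := ofCoords_mem_levelTwo (a := 0) (b := -1) (c := -1) (d := 0) 4 (by norm_num)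
  have h₄ := ofCoords_mem_levelTwo (a := 0) (b := 0) (c := -1) (d := 1) 4 (by norm_num)
  have h := add_three_mul_mem_levelTwo
    (add_mem (add_mem (add_mem (algebraMap_mul_mem_levelTwo a h₁)
      (algebraMap_mul_mem_levelTwo (c + d - b) h₂)) (algebraMap_mul_mem_levelTwo (c + d + b) h₃))
      (algebraMap_mul_mem_levelTwo d h₄)) (ofCoords_mem_maximalOrderB3 0 b (c + d) 0)
  convert h using 1
  rw [← map_ofNat (algebraMap ℚ_[3] ℍ[ℚ_[3], -1, -3]) 3]
  simp only [algebraMap_mul_ofCoords, ofCoords_add]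
  push_cast
  congr 1 <;> ring

lemma exists_pow_two_of_centered : ∀ a ∈ Finset.Icc (-1 : ℤ) 1, ∀ b ∈ Finset.Icc (-1 : ℤ) 1,
    ∀ c ∈ Finset.Icc (-1 : ℤ) 1, ∀ d ∈ Finset.Icc (-1 : ℤ) 1, (a = c ∧ b = d) ∨
      ∃ m ∈ Finset.range 3, a ^ 2 + a * c + c ^ 2 + b ^ 2 + b * d + d ^ 2 = 2 ^ m := by
  decide

lemma approx_one_of_isUnit {x x' : ℍ[ℚ_[3], -1, -3]} (hx : x ∈ MaximalOrderB3)
    (hx' : x' ∈ MaximalOrderB3) (h : x * x' = 1) : Approx 1 x := by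
  obtain ⟨a, b, c, d, rfl⟩ := exists_ofCoords_of_mem_maximalOrderB3 hx
  obtain ⟨a', b', c', d', rfl⟩ := exists_ofCoords_of_mem_maximalOrderB3 hx'
  have hN := congr_arg normForm h
  rw [normForm_mul, normForm_ofCoords, normForm_ofCoords] at hN
  have h1 : normForm (1 : ℍ[ℚ_[3], -1, -3]) = 1 := by simp [normForm]
  rw [h1] at hN
  norm_cast at hN
  obtain ⟨a₀, ha, a₁, rfl⟩ := exists_padicInt_eq_int_add_three_mul a
  obtain ⟨b₀, hb, b₁, rfl⟩ := exists_padicInt_eq_int_add_three_mul b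
  obtain ⟨c₀, hc, c₁, rfl⟩ := exists_padicInt_eq_int_add_three_mul c
  obtain ⟨d₀, hd, d₁, rfl⟩ := exists_padicInt_eq_int_add_three_mul d
  rcases exists_pow_two_of_centered a₀ ha b₀ hb c₀ hc d₀ hd with ⟨rfl, rfl⟩ | ⟨m, -, hm⟩
  · replace hN := PadicInt.ext (hN.trans PadicInt.coe_one.symm)
    refine absurd (IsUnit.of_mul_eq_one
      ((a₀ ^ 2 + 3 * a₀ * (a₁ + c₁) + 3 * (a₁ ^ 2 + a₁ * c₁ + c₁ ^ 2)
        + b₀ ^ 2 + 3 * b₀ * (b₁ + d₁) + 3 * (b₁ ^ 2 + b₁ * d₁ + d₁ ^ 2))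
        * (a' ^ 2 + a' * c' + c' ^ 2 + b' ^ 2 + b' * d' + d' ^ 2)) ?_)
        (PadicInt.prime_p (p := 3)).not_isUnit
    rw [← hN]
    push_cast
    ring
  · refine (approx_iotaHom 1 (ofCoords_intCast_mem_Gamma m hm)).of_congr
      (ofCoords_mem_maximalOrderB3 a₁ b₁ c₁ d₁) ?_
    rw [iotaHom_ofCoords, pow_one, ← map_ofNat (algebraMap ℚ_[3] ℍ[ℚ_[3], -1, -3]) 3,
      algebraMap_mul_ofCoords, ofCoords_add]
    push_cast
    rfl

lemma Approx.of_one_add {n m : ℕ} {x : ℍ[ℚ_[3], -1, -3]} (hx : Approx n x)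
    (h : ∀ y ∈ MaximalOrderB3, Approx m (1 + 3 ^ n * y)) : Approx m x := by
  obtain ⟨γ, hγ, y, hy, rfl⟩ := hx.exists_factor
  exact (approx_iotaHom m hγ).mul (h y hy)

/-- Cubing carries `1 + 3ⁿ⁺¹ O₃` onto `1 + 3ⁿ⁺² O₃` modulo `3ⁿ⁺³`. -/
lemma approx_one_add (n : ℕ) : ∀ y ∈ MaximalOrderB3, Approx (n + 2) (1 + 3 ^ (n + 1) * y) := by
  induction n with
  | zero => intro y hy; simpa using (mem_levelTwo hy).2
  | succ n ih =>
    intro y hy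
    obtain ⟨γ, hγ, z, hz, h⟩ := ih y hy
    refine (approx_iotaHom _ (pow_mem hγ 3)).of_congr
      (y := z - 3 ^ n * (y - 3 * z) ^ 2 - 3 ^ (2 * n) * (y - 3 * z) ^ 3) ?_ ?_
    · have hw : y - 3 * z ∈ MaximalOrderB3 := sub_mem hy (mul_mem (ofNat_mem _ 3) hz)
      exact sub_mem (sub_mem hz (mul_mem (three_pow_mem _) (pow_mem hw 2)))
        (mul_mem (three_pow_mem _) (pow_mem hw 3))
    · have hγ' : iotaHom γ = 1 + 3 ^ (n + 1) * (y - 3 * z) := by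
        rw [eq_sub_of_add_eq h.symm]
        rw [mul_sub, ← mul_assoc, ← pow_succ]
        abel
      set w := y - 3 * z with hw
      have hy : y = w + 3 * z := by rw [hw]; abel
      have hc : Commute ((3 : ℍ[ℚ_[3], -1, -3]) ^ (n + 1)) w :=
        (Commute.ofNat_left 3 w).pow_left _
      have h2 : (3 ^ (n + 1) * w) ^ 2 = 3 ^ (2 * n + 2) * w ^ 2 := by
        rw [hc.mul_pow, ← pow_mul]; congr 2; ring
      have h3 : (3 ^ (n + 1) * w) ^ 3 = 3 ^ (3 * n + 3) * w ^ 3 := by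
        rw [hc.mul_pow, ← pow_mul]; congr 2; ring
      have hcube (t : ℍ[ℚ_[3], -1, -3]) : (1 + t) ^ 3 = 1 + 3 * t + 3 * t ^ 2 + t ^ 3 := by
        noncomm_ring
      rw [map_pow, hγ', hcube, h2, h3, hy]
      have hsmul (k : ℕ) (t : ℍ[ℚ_[3], -1, -3]) : 3 ^ k * t = (3 ^ k : ℤ) • t := by
        rw [zsmul_eq_mul]; push_cast; rfl
      have hsmul' (t : ℍ[ℚ_[3], -1, -3]) : 3 * t = (3 : ℤ) • t := by
        simp [zsmul_eq_mul]
      simp only [hsmul, hsmul']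
      module

/-- **Density of `Γ` in `𝕊₂` at `p = 3`, `ℓ = 2`.**  Every unit `x` of the maximal order
`O₃` is approximated `3`-adically to arbitrary precision by elements of `O[1/2]` of
reduced norm a power of `2`. -/
theorem gamma_dense_in_morava_stabilizer_p3 (x : ℍ[ℚ_[3], -1, -3])
    (hx : x ∈ MaximalOrderB3)
    (hxunit : ∃ x' ∈ MaximalOrderB3, x * x' = 1 ∧ x' * x = 1)
    (n : ℕ) :
    ∃ γ : ℍ[ℚ, -1, -3], γ ∈ MaximalOrderBInvTwo ∧ (∃ k : ℤ, normSqB γ = 2 ^ k) ∧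
      ∃ y ∈ MaximalOrderB3, x - iotaB γ = 3 ^ n * y := by
  obtain ⟨x', hx', hxx', -⟩ := hxunit
  have key (m : ℕ) : Approx (m + 1) x := by
    induction m with
    | zero => exact approx_one_of_isUnit hx hx' hxx'
    | succ m ih => exact ih.of_one_add (approx_one_add m)
  obtain ⟨γ, ⟨hγ, k, hk⟩, y, hy, h⟩ := key n
  refine ⟨γ, hγ, ⟨k, (normSqB_eq_normForm γ).trans hk⟩, 3 * y, mul_mem (ofNat_mem _ 3) hy, ?_⟩
  rw [h, pow_succ, mul_assoc]
  exact add_sub_cancel_left _ _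
end
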